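/- Let t be a fine infinite word over a finite alphabet A, witnessed by the infinite word s (so min(t) = a·s for every order with a = min(A)). Then s is a standard episturmian word. -/

import Mathlib

/-- The prefix of length `k` of an infinite word `w : ℕ → A`. -/
def pref {A : Type*} (w : ℕ → A) (k : ℕ) : List A := (List.range k).map w

/-- `u` is a (finite) factor of the infinite word `w`. -/
def IsFactor {A : Type*} (w : ℕ → A) (u : List A) : Prop :=
  ∃ i : ℕ, u = (List.range u.length).map (fun j => w (i + j))

/-- Prepend a letter to an infinite word. -/
def consW {A : Type*} (a : A) (s : ℕ → A) : ℕ → A := fun n => match n with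
  | 0 => a
  | n + 1 => s n

/-- Concatenation of a finite word with an infinite word. -/
def catW {A : Type*} (u : List A) (w : ℕ → A) : ℕ → A := fun n =>
  if h : n < u.length then u.get ⟨n, h⟩ else w (n - u.length)

/-- `u` is the lexicographically smallest factor of `w` of length `k`,
w.r.t. the strict order `lt` on letters. -/
def IsMinFactor {A : Type*} (lt : A → A → Prop) (w : ℕ → A) (k : ℕ) (u : List A) : Prop :=
  IsFactor w u ∧ u.length = k ∧
    ∀ v, IsFactor w v → v.length = k → u = v ∨ List.Lex lt u v

/-- `u` is the lexicographically greatest factor of `w` of length `k`. -/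
def IsMaxFactor {A : Type*} (lt : A → A → Prop) (w : ℕ → A) (k : ℕ) (u : List A) : Prop :=
  IsFactor w u ∧ u.length = k ∧
    ∀ v, IsFactor w v → v.length = k → u = v ∨ List.Lex lt v u

/-- `m = min(w)`: every length-`k` prefix of `m` is the lexicographically
smallest factor of `w` of length `k`. -/
def IsMinWord {A : Type*} (lt : A → A → Prop) (w m : ℕ → A) : Prop :=
  ∀ k : ℕ, IsMinFactor lt w k (pref m k)

/-- `m = max(w)`. -/
def IsMaxWord {A : Type*} (lt : A → A → Prop) (w m : ℕ → A) : Prop :=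
  ∀ k : ℕ, IsMaxFactor lt w k (pref m k)

/-- The letter `z` is separating for `t`: every length-2 factor of `t` contains `z`. -/
def Separating {A : Type*} (z : A) (t : ℕ → A) : Prop :=
  ∀ u, IsFactor t u → u.length = 2 → z ∈ u

/-- The episturmian morphism `Ψ_z` on finite words: `z ↦ z`, `x ↦ zx` for `x ≠ z`. -/
def psiL {A : Type*} [DecidableEq A] (z : A) (u : List A) : List A :=
  u.flatMap (fun x => if x = z then [z] else [z, x])

/-- `t = Ψ_z(y)` for infinite words: the `Ψ_z`-image of every prefix of `y`
is a prefix of `t`. -/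
def PsiImage {A : Type*} [DecidableEq A] (z : A) (y t : ℕ → A) : Prop :=
  ∀ n : ℕ, psiL z (pref y n) = pref t (psiL z (pref y n)).length

/-- `u` is a left special factor of `w`. -/
def LeftSpecial {A : Type*} (w : ℕ → A) (u : List A) : Prop :=
  ∃ a b : A, a ≠ b ∧ IsFactor w (a :: u) ∧ IsFactor w (b :: u)

/-- `u` is a right special factor of `w`. -/
def RightSpecial {A : Type*} (w : ℕ → A) (u : List A) : Prop :=
  ∃ a b : A, a ≠ b ∧ IsFactor w (u ++ [a]) ∧ IsFactor w (u ++ [b])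

/-- `w` is a standard episturmian word: factors closed under reversal and
every left special factor is a prefix. -/
def StdEpisturmian {A : Type*} (w : ℕ → A) : Prop :=
  (∀ u, IsFactor w u → IsFactor w u.reverse) ∧
  (∀ u, LeftSpecial w u → u = pref w u.length)

/-- `w` is an `A`-strict standard episturmian word (standard Arnoux-Rauzy sequence):
standard episturmian and every prefix has every letter as a left extension. -/
def StrictStdEpisturmian {A : Type*} (w : ℕ → A) : Prop :=
  StdEpisturmian w ∧ ∀ (n : ℕ) (a : A), IsFactor w (a :: pref w n)

/-- `w` is episturmian: factors closed under reversal and at most one right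
special factor of each length. -/
def Episturmian {A : Type*} (w : ℕ → A) : Prop :=
  (∀ u, IsFactor w u → IsFactor w u.reverse) ∧
  (∀ u v, RightSpecial w u → RightSpecial w v → u.length = v.length → u = v)

/-- `w` is an `A`-strict episturmian word: it has the same set of factors as some
`A`-strict standard episturmian word. -/
def StrictEpisturmian {A : Type*} (w : ℕ → A) : Prop :=
  ∃ s : ℕ → A, StrictStdEpisturmian s ∧ ∀ u, IsFactor w u ↔ IsFactor s u

/-- `t` is fine: there is an infinite word `s` such that for every total order on the
alphabet and every letter `a` minimal for that order, `min(t) = a·s`. -/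
def Fine {A : Type*} (t : ℕ → A) : Prop :=
  ∃ s : ℕ → A, ∀ (l : LinearOrder A) (a : A), (∀ b, l.le a b) →
    IsMinWord l.lt t (consW a s)

/-- `u` occurs in `s` at position `i`. -/
def Occ {A : Type*} (s : ℕ → A) : ℕ → List A → Prop
  | _, [] => True
  | i, a :: u => s i = a ∧ Occ s (i + 1) u

theorem occ_append {A : Type*} (s : ℕ → A) (u v : List A) (i : ℕ) :
    Occ s i (u ++ v) ↔ Occ s i u ∧ Occ s (i + u.length) v := by
  induction u generalizing i with
  | nil => simp [Occ]
  | cons a u ih =>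
    simp only [List.cons_append, Occ, ih, List.length_cons, and_assoc]
    rw [show i + 1 + u.length = i + (u.length + 1) by omega]

theorem occ_iff {A : Type*} (s : ℕ → A) (u : List A) (i : ℕ) :
    Occ s i u ↔ u = (List.range u.length).map (fun j => s (i + j)) := by
  induction u generalizing i with
  | nil => simp [Occ]
  | cons a u ih =>
    have e : (fun j => s (i + 1 + j)) = (fun j => s (i + j)) ∘ Nat.succ := by
      funext j; simp only [Function.comp]; congr 1; omega
    simp only [Occ, ih, List.length_cons, List.range_succ_eq_map, List.map_cons, List.map_map,
      List.cons.injEq, Nat.add_zero, e]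
    constructor
    · rintro ⟨h1, h2⟩; exact ⟨h1.symm, h2⟩
    · rintro ⟨h1, h2⟩; exact ⟨h1.symm, h2⟩

theorem isFactor_iff {A : Type*} (s : ℕ → A) (u : List A) :
    IsFactor s u ↔ ∃ i, Occ s i u := by
  simp only [occ_iff, IsFactor]

theorem pref_iff {A : Type*} (s : ℕ → A) (u : List A) :
    u = pref s u.length ↔ Occ s 0 u := by
  simp only [occ_iff, pref, Nat.zero_add]

theorem occ_shift {A : Type*} (s t : ℕ → A) (a b : ℕ) (hst : ∀ j, s (a + j) = t (b + j))
    (u : List A) : Occ s a u ↔ Occ t b u := by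
  simp only [occ_iff, hst]

theorem exists_occ {A : Type*} (s : ℕ → A) (i n : ℕ) : ∃ u, u.length = n ∧ Occ s i u := by
  refine ⟨(List.range n).map (fun j => s (i + j)), by simp, ?_⟩
  rw [occ_iff]; simp

/-- The combinatorial form of `x s ≤ min(w)`. -/
def PropP {A : Type*} (w s : ℕ → A) : Prop :=
  ∀ i x p c d, Occ w i (x :: (p ++ [c])) → Occ s 0 (p ++ [d]) → c = d ∨ x = d

theorem exists_order {A : Type*} [Fintype A] (x c : A) :
    ∃ l : LinearOrder A, (∀ b, l.le x b) ∧ ∀ d, c ≠ d → x ≠ d → l.lt c d := by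
  classical
  let e := Fintype.equivFin A
  let f : A → ℕ := fun y => if y = x then 0 else if y = c then 1 else (e y : ℕ) + 2
  have hf : Function.Injective f := by
    intro y z hyz
    simp only [f] at hyz
    split_ifs at hyz <;> first | (subst_vars; rfl) | omega | skip
    apply e.injective
    apply Fin.ext
    omega
  refine ⟨LinearOrder.lift' f hf, ?_, ?_⟩
  · intro b
    change f x ≤ f b
    simp [f]
  · intro d h1 h2
    change f c < f d
    simp only [f, if_neg h1.symm, if_neg h2.symm]
    split_ifs <;> omega

theorem not_lex {A : Type*} (l : LinearOrder A) (c d : A) (hcd : l.lt c d) (p : List A) :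
    ¬ List.Lex l.lt (p ++ [d]) (p ++ [c]) := by
  let := l
  induction p with
  | nil =>
    intro h
    cases h with
    | rel h => exact lt_asymm h hcd
    | cons h => cases h
  | cons a p ih =>
    intro h
    cases h with
    | rel h => exact lt_irrefl _ h
    | cons h => exact ih h

theorem occ_consW {A : Type*} (x : A) (s : ℕ → A) (u : List A) :
    Occ (consW x s) 0 (x :: u) ↔ Occ s 0 u := by
  simp only [Occ, consW, true_and]
  apply occ_shift
  intro j
  rw [show 0 + 1 + j = j + 1 by omega, Nat.zero_add]
  rfl

theorem propP_of_fine {A : Type*} [Fintype A] (t s : ℕ → A)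
    (h : ∀ (l : LinearOrder A) (a : A), (∀ b, l.le a b) → IsMinWord l.lt t (consW a s)) :
    PropP t s := by
  intro i x p c d h1 h2
  by_contra hc
  push Not at hc
  obtain ⟨l, hl, hl2⟩ := exists_order x c
  obtain ⟨-, -, hm⟩ := h l x hl (p.length + 2)
  have h3 := (pref_iff _ _).2 ((occ_consW x s _).2 h2)
  have h4 : (x :: (p ++ [d])).length = p.length + 2 := by simp
  rw [h4] at h3
  rw [← h3] at hm
  rcases hm (x :: (p ++ [c])) ((isFactor_iff _ _).2 ⟨i, h1⟩) (by simp) with h5 | h5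
  · simp at h5
    exact hc.1 h5.symm
  · exact not_lex l c d (hl2 d hc.1 hc.2) (x :: p) h5

theorem factor_t {A : Type*} [Fintype A] (t s : ℕ → A)
    (h : ∀ (l : LinearOrder A) (a : A), (∀ b, l.le a b) → IsMinWord l.lt t (consW a s))
    (i : ℕ) (u : List A) (hu : Occ s i u) : ∃ j, Occ t j u := by
  obtain ⟨v, hv, hv2⟩ := exists_occ s 0 i
  obtain ⟨l, hl, -⟩ := exists_order (s 0) (s 0)
  have h1 : Occ s 0 (v ++ u) := by
    rw [occ_append, hv, Nat.zero_add]; exact ⟨hv2, hu⟩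
  have h2 := (pref_iff _ _).2 ((occ_consW (s 0) s _).2 h1)
  obtain ⟨hf, -, -⟩ := h l (s 0) hl (s 0 :: (v ++ u)).length
  rw [← h2, isFactor_iff] at hf
  obtain ⟨j, hj⟩ := hf
  exact ⟨_, ((occ_append t v u (j + 1)).1 hj.2).2⟩

theorem leftSpecial_pref {A : Type*} (s : ℕ → A) (hP : PropP s s) (x y : A) (hxy : x ≠ y)
    (i j : ℕ) (u : List A) (hx : Occ s i (x :: u)) (hy : Occ s j (y :: u)) : Occ s 0 u := by
  induction u using List.reverseRecOn with
  | nil => trivial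
  | append_singleton p c ih =>
    have hp : Occ s 0 p := by
      apply ih
      · exact ((occ_append s (x :: p) [c] i).1 hx).1
      · exact ((occ_append s (y :: p) [c] j).1 hy).1
    have hd : Occ s 0 (p ++ [s (0 + p.length)]) := by
      rw [occ_append]; exact ⟨hp, rfl, trivial⟩
    rcases hP _ _ _ _ _ hx hd with h1 | h1
    · rw [h1]; exact hd
    · rcases hP _ _ _ _ _ hy hd with h2 | h2
      · rw [h2]; exact hd
      · exact absurd (h1.trans h2.symm) hxy

open Classical in
/-- Start of the `k`-th block. -/
noncomputable def bpos {A : Type*} (s : ℕ → A) : ℕ → ℕ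
  | 0 => 0
  | k + 1 => bpos s k + (if s (bpos s k + 1) = s 0 then 1 else 2)

/-- The desubstituted word. -/
noncomputable def desub {A : Type*} (s : ℕ → A) (k : ℕ) : A := s (bpos s k + 1)

theorem sep_of_propP {A : Type*} (s : ℕ → A) (hP : PropP s s) (i : ℕ) :
    s (i + 1) = s 0 ∨ s i = s 0 :=
  hP i (s i) [] (s (i + 1)) (s 0) ⟨rfl, rfl, trivial⟩ ⟨rfl, trivial⟩

theorem bpos_eq {A : Type*} (s : ℕ → A) (k : ℕ) (h : s (bpos s k + 1) = s 0) :
    bpos s (k + 1) = bpos s k + 1 := by simp [bpos, h]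

theorem bpos_ne {A : Type*} (s : ℕ → A) (k : ℕ) (h : s (bpos s k + 1) ≠ s 0) :
    bpos s (k + 1) = bpos s k + 2 := by simp [bpos, h]

theorem s_bpos {A : Type*} (s : ℕ → A) (hP : PropP s s) (k : ℕ) : s (bpos s k) = s 0 := by
  cases k with
  | zero => rfl
  | succ k =>
    by_cases h : s (bpos s k + 1) = s 0
    · rw [bpos_eq s k h, h]
    · rw [bpos_ne s k h]
      exact (sep_of_propP s hP (bpos s k + 1)).resolve_right h

theorem psiL_cons {A : Type*} [DecidableEq A] (z a : A) (u : List A) :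
    psiL z (a :: u) = (if a = z then [z] else [z, a]) ++ psiL z u := by
  simp [psiL]

theorem psiL_append {A : Type*} [DecidableEq A] (z : A) (u v : List A) :
    psiL z (u ++ v) = psiL z u ++ psiL z v := by
  simp [psiL]

theorem psiL_reverse {A : Type*} [DecidableEq A] (z : A) (u : List A) :
    (psiL z u ++ [z]).reverse = psiL z u.reverse ++ [z] := by
  induction u with
  | nil => simp [psiL]
  | cons a u ih =>
    rw [psiL_cons, List.append_assoc, List.reverse_append, ih, List.reverse_cons, psiL_append]
    split_ifs with h <;> simp [psiL, h]

theorem occ_img {A : Type*} [DecidableEq A] (s : ℕ → A) (hP : PropP s s) (u : List A) (k : ℕ)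
    (hu : Occ (desub s) k u) : Occ s (bpos s k) (psiL (s 0) u ++ [s 0]) := by
  induction u generalizing k with
  | nil => exact ⟨s_bpos s hP k, trivial⟩
  | cons a u ih =>
    obtain ⟨h1, h2⟩ := hu
    have h3 := ih _ h2
    rw [psiL_cons]
    change s (bpos s k + 1) = a at h1
    by_cases h : a = s 0
    · rw [bpos_eq s k (h1.trans h)] at h3
      rw [if_pos h]
      exact ⟨s_bpos s hP k, h3⟩
    · rw [bpos_ne s k (by rw [h1]; exact h)] at h3
      rw [if_neg h]
      exact ⟨s_bpos s hP k, h1, h3⟩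

theorem psi_last {A : Type*} [DecidableEq A] (z c : A) (p : List A) :
    ∃ w, psiL z (p ++ [c]) ++ [z] = (psiL z p ++ [z]) ++ [c] ++ w := by
  by_cases h : c = z
  · exact ⟨[], by simp [psiL, h]⟩
  · exact ⟨[z], by simp [psiL, h]⟩

theorem propP_desub {A : Type*} (s : ℕ → A) (hP : PropP s s) : PropP (desub s) (desub s) := by
  classical
  intro i x p c e h1 h2
  have h1 := occ_img s hP _ _ h1
  have h2 := occ_img s hP _ _ h2
  obtain ⟨w1, hw1⟩ := psi_last (s 0) c p
  obtain ⟨w2, hw2⟩ := psi_last (s 0) e p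
  rw [hw2, occ_append] at h2
  rw [psiL_cons, List.append_assoc, hw1] at h1
  have h3 : ∃ j, Occ s j (x :: ((psiL (s 0) p ++ [s 0]) ++ [c])) := by
    by_cases h : x = s 0
    · rw [if_pos h, ← h] at h1
      rw [← h]
      rw [← List.append_assoc, occ_append] at h1
      exact ⟨_, h1.1⟩
    · rw [if_neg h, ← List.append_assoc, occ_append] at h1
      exact ⟨_, h1.1.2⟩
  obtain ⟨j, h3⟩ := h3
  exact hP j x _ c e h3 h2.1

theorem pos_cover {A : Type*} (s : ℕ → A) (i : ℕ) :
    ∃ k, i = bpos s k ∨ (i = bpos s k + 1 ∧ s i ≠ s 0) := by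
  induction i with
  | zero => exact ⟨0, Or.inl rfl⟩
  | succ i ih =>
    obtain ⟨k, h | ⟨h, h'⟩⟩ := ih
    · by_cases hs : s (bpos s k + 1) = s 0
      · exact ⟨k + 1, Or.inl (by rw [bpos_eq s k hs, h])⟩
      · exact ⟨k, Or.inr ⟨by rw [h], by rw [h]; exact hs⟩⟩
    · refine ⟨k + 1, Or.inl ?_⟩
      rw [h] at h'
      rw [bpos_ne s k h', h]

theorem cover {A : Type*} [DecidableEq A] (s : ℕ → A) (hP : PropP s s) (n : ℕ) :
    ∀ (u : List A) (k : ℕ), u.length ≤ n → u ≠ [] → Occ s (bpos s k) u →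
    ∃ u' w, u'.length < u.length ∧ Occ (desub s) k u' ∧ psiL (s 0) u' ++ [s 0] = u ++ w := by
  induction n with
  | zero => intro u k hn hne; simp at hn; exact absurd hn hne
  | succ n ih =>
    intro u k hn hne hu
    match u, hn, hu with
    | [a], _, hu =>
      have : a = s 0 := hu.1.symm.trans (s_bpos s hP k)
      exact ⟨[], [], by simp, trivial, by simp [psiL, this]⟩
    | a :: b :: r, hn, hu =>
      have ha : a = s 0 := hu.1.symm.trans (s_bpos s hP k)
      obtain ⟨-, hb, hr⟩ := hu
      by_cases h : b = s 0
      · have hk := bpos_eq s k (hb.trans h)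
        obtain ⟨u', w, h1, h2, h3⟩ := ih (b :: r) (k + 1) (by simp at hn ⊢; omega) (by simp)
          (by rw [hk]; exact ⟨hb, hr⟩)
        refine ⟨b :: u', w, by simp at h1 ⊢; omega, ⟨hb, h2⟩, ?_⟩
        rw [psiL_cons, if_pos h, List.append_assoc, h3, ha]; rfl
      · have hk := bpos_ne s k (by rw [hb]; exact h)
        by_cases hr0 : r = []
        · refine ⟨[b], [s 0], by simp, ⟨hb, trivial⟩, by simp [psiL, h, ha, hr0]⟩
        · obtain ⟨u', w, h1, h2, h3⟩ := ih r (k + 1) (by simp at hn ⊢; omega) hr0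
            (by rw [hk]; exact hr)
          refine ⟨b :: u', w, by simp at h1 ⊢; omega, ⟨hb, h2⟩, ?_⟩
          rw [psiL_cons, if_neg h, List.append_assoc, h3, ha]; rfl

theorem cover' {A : Type*} [DecidableEq A] (s : ℕ → A) (hP : PropP s s) (u : List A) (i : ℕ)
    (hu : Occ s i u) (hl : 2 ≤ u.length) :
    ∃ k u' v w, u'.length < u.length ∧ Occ (desub s) k u' ∧
      psiL (s 0) u' ++ [s 0] = v ++ u ++ w := by
  obtain ⟨k, h | ⟨h, h'⟩⟩ := pos_cover s i
  · obtain ⟨u', w, h1, h2, h3⟩ := cover s hP u.length u k le_rfl (by rintro rfl; simp at hl)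
      (h ▸ hu)
    exact ⟨k, u', [], w, h1, h2, by simpa using h3⟩
  · match u, hl, hu with
    | y :: r, hl, hu =>
      obtain ⟨hy, hr⟩ := hu
      rw [h] at h' hr hy
      have hk := bpos_ne s k h'
      obtain ⟨u', w, h1, h2, h3⟩ := cover s hP r.length r (k + 1) le_rfl
        (by rintro rfl; simp at hl) (by rw [hk]; exact hr)
      refine ⟨k, y :: u', [s 0], w, by simp; omega, ⟨hy, h2⟩, ?_⟩
      rw [psiL_cons, if_neg (by rw [← hy]; exact h'), List.append_assoc, h3]; rfl

theorem reverse_closed {A : Type*} (n : ℕ) : ∀ (s : ℕ → A), PropP s s → ∀ (u : List A) (i : ℕ),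
    u.length ≤ n → Occ s i u → ∃ j, Occ s j u.reverse := by
  classical
  induction n with
  | zero =>
    intro s hP u i hn hu
    simp at hn
    subst hn
    exact ⟨0, trivial⟩
  | succ n ih =>
    intro s hP u i hn hu
    by_cases hl : 2 ≤ u.length
    · obtain ⟨k, u', v, w, h1, h2, h3⟩ := cover' s hP u i hu hl
      obtain ⟨j, hj⟩ := ih (desub s) (propP_desub s hP) u' k (by omega) h2
      have := occ_img s hP _ _ hj
      rw [← psiL_reverse, h3, List.reverse_append, List.reverse_append, occ_append,
        occ_append] at this
      exact ⟨_, this.2.1⟩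
    · match u, hl, hu with
      | [], _, _ => exact ⟨0, trivial⟩
      | [a], _, hu => exact ⟨i, hu⟩
      | a :: b :: r, hl, _ => simp at hl

/-- If `t` is fine with witness `s`, then `s` is standard episturmian. -/
theorem stmt_10 {A : Type*} [Fintype A] (t s : ℕ → A)
    (h : ∀ (l : LinearOrder A) (a : A), (∀ b, l.le a b) → IsMinWord l.lt t (consW a s)) :
    StdEpisturmian s := by
  have hP : PropP s s := by
    intro i x p c d h1 h2
    obtain ⟨j, hj⟩ := factor_t t s h i _ h1
    exact propP_of_fine t s h j x p c d hj h2
  constructor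
  · intro u hu
    rw [isFactor_iff] at hu ⊢
    obtain ⟨i, hi⟩ := hu
    exact reverse_closed u.length s hP u i le_rfl hi
  · rintro u ⟨a, b, hab, ha, hb⟩
    rw [isFactor_iff] at ha hb
    obtain ⟨i, hi⟩ := ha
    obtain ⟨j, hj⟩ := hb
    exact (pref_iff s u).2 (leftSpecial_pref s hP a b hab i j u hi hj)
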